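/- The Cauchy problem y^{(m)}(z) = A y(z), y^{(k)}(0) = y_k (k = 0,…,m−1) has a solution that is an entire 𝔅-valued function (a power series y(z) = Σ_j c_j z^j with ‖c_j‖ r^j → 0 for every r > 0, with values in 𝒟(A), satisfying the equation on all of ℂ_[p]) if and only if y_k ∈ ⋂_{α>0} E_α(A) for every k = 0,…,m−1. -/

import Mathlib

open Filter Topology

/-!
STATEMENT 7 (entire solutions). `ℂ_[p]` is axiomatized as a complete, algebraically
closed, nonarchimedean nontrivially normed field `K` with an isometric `ℚ_[p]`-algebra
structure; the closed operator `A` with domain `D` is a submodule `D` with a total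
linear map `A` whose graph over `D` is closed.
-/

/-- `y(z) = Σ cⱼ zʲ` is an entire `𝔅`-valued solution of the Cauchy problem
`y⁽ᵐ⁾ = A y`, `y⁽ᵏ⁾(0) = yinit k` (`k = 0, …, m-1`): the coefficients satisfy
`‖cⱼ‖ rʲ → 0` for every `r > 0`, and the equation holds on all of the field. -/
def IsEntireCauchySolution {K : Type*} [NontriviallyNormedField K]
    {B : Type*} [NormedAddCommGroup B] [NormedSpace K B]
    (D : Submodule K B) (A : B →ₗ[K] B) (m : ℕ) (yinit : ℕ → B)
    (y : K → B) (c : ℕ → B) : Prop :=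
  (∀ r : ℝ, 0 < r → Filter.Tendsto (fun j : ℕ => ‖c j‖ * r ^ j) Filter.atTop (nhds 0)) ∧
  (∀ z : K, HasSum (fun j : ℕ => z ^ j • c j) (y z)) ∧
  (∀ z : K, y z ∈ D) ∧
  (∀ i < m, ∀ z : K, DifferentiableAt K (iteratedDeriv i y) z) ∧
  (∀ z : K, iteratedDeriv m y z = A (y z)) ∧
  (∀ k < m, iteratedDeriv k y 0 = yinit k ∧ (k.factorial : K) • c k = yinit k)

section PowerSeries

variable {K : Type*} [NontriviallyNormedField K]
  {E : Type*} [NormedAddCommGroup E] [NormedSpace K E]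

/-- The power series `Σ zʲ cⱼ` in one variable. -/
noncomputable def powerSeriesOfCoeff (K : Type*) [NontriviallyNormedField K] {E : Type*}
    [NormedAddCommGroup E] [NormedSpace K E] (c : ℕ → E) : FormalMultilinearSeries K K E :=
  fun n => ContinuousMultilinearMap.mkPiRing K (Fin n) (c n)

theorem coeff_powerSeriesOfCoeff (c : ℕ → E) (n : ℕ) :
    (powerSeriesOfCoeff K c).coeff n = c n := by
  simp [FormalMultilinearSeries.coeff, powerSeriesOfCoeff]

theorem hasFPowerSeriesOnBall_top_of_hasSum {f : K → E} {c : ℕ → E}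
    (h : ∀ z : K, HasSum (fun j : ℕ => z ^ j • c j) (f z)) :
    HasFPowerSeriesOnBall f (powerSeriesOfCoeff K c) 0 ⊤ where
  r_le := by
    refine ENNReal.le_of_forall_nnreal_lt fun r _ => ?_
    obtain ⟨z, hz⟩ := NormedField.exists_lt_norm K r
    have hrz : (r : ENNReal) ≤ (‖z‖₊ : ENNReal) := by exact_mod_cast hz.le
    refine hrz.trans (FormalMultilinearSeries.le_radius_of_tendsto _ (l := 0) ?_)
    simpa [powerSeriesOfCoeff, norm_smul, mul_comm] using (h z).summable.tendsto_atTop_zero.norm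
  r_pos := ENNReal.zero_lt_top
  hasSum := fun {z} _ => by simpa [powerSeriesOfCoeff] using h z

theorem differentiable_of_hasSum [CompleteSpace E] {f : K → E} {c : ℕ → E}
    (h : ∀ z : K, HasSum (fun j : ℕ => z ^ j • c j) (f z)) : Differentiable K f := fun z =>
  ((hasFPowerSeriesOnBall_top_of_hasSum h).analyticAt_of_mem (by simp)).differentiableAt

theorem hasSum_deriv_of_hasSum [CompleteSpace E] {f : K → E} {c : ℕ → E}
    (h : ∀ z : K, HasSum (fun j : ℕ => z ^ j • c j) (f z)) (z : K) :
    HasSum (fun j : ℕ => z ^ j • ((j + 1 : ℕ) : K) • c (j + 1)) (deriv f z) := by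
  have h1 := ((hasFPowerSeriesOnBall_top_of_hasSum h).fderiv.hasSum (y := z) (by simp)).mapL
    (ContinuousLinearMap.apply K E (1 : K))
  simp only [zero_add, ContinuousLinearMap.apply_apply, fderiv_apply_one_eq_deriv] at h1
  refine h1.congr_fun fun j => ?_
  rw [FormalMultilinearSeries.apply_eq_pow_smul_coeff, smul_apply,
    FormalMultilinearSeries.derivSeries_coeff_one, coeff_powerSeriesOfCoeff,
    Nat.cast_smul_eq_nsmul]

theorem hasSum_iteratedDeriv_of_hasSum [CompleteSpace E] {f : K → E} {c : ℕ → E}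
    (h : ∀ z : K, HasSum (fun j : ℕ => z ^ j • c j) (f z)) (i : ℕ) (z : K) :
    HasSum (fun j : ℕ => z ^ j • ((j + 1).ascFactorial i : K) • c (j + i))
      (iteratedDeriv i f z) := by
  induction i generalizing z with
  | zero => simpa using h z
  | succ i ih =>
    rw [iteratedDeriv_succ]
    convert hasSum_deriv_of_hasSum ih z using 3 with j
    rw [smul_smul, ← Nat.cast_mul, Nat.succ_ascFactorial, Nat.ascFactorial_succ,
      add_right_comm j 1 i, add_assoc j i 1]

theorem iteratedDeriv_zero_of_hasSum [CompleteSpace E] {f : K → E} {c : ℕ → E}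
    (h : ∀ z : K, HasSum (fun j : ℕ => z ^ j • c j) (f z)) (i : ℕ) :
    iteratedDeriv i f 0 = (i.factorial : K) • c i := by
  have h0 := hasSum_single (f := fun j : ℕ => (0 : K) ^ j •
    ((j + 1).ascFactorial i : K) • c (j + i)) 0 fun j hj => by simp [hj]
  simpa [Nat.one_ascFactorial] using (hasSum_iteratedDeriv_of_hasSum h i 0).unique h0

theorem iteratedDeriv_mem_of_isClosed {f : K → E} {G : Submodule K E}
    (hG : IsClosed (G : Set E)) (hf : ∀ z, f z ∈ G) (i : ℕ) (z : K) :
    iteratedDeriv i f z ∈ G := by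
  induction i generalizing z with
  | zero => simpa using hf z
  | succ i ih =>
    rw [iteratedDeriv_succ]
    refine closure_minimal ?_ hG
      (range_deriv_subset_closure_span_image (iteratedDeriv i f) dense_univ ⟨z, rfl⟩)
    exact Submodule.span_le.2 (by rintro _ ⟨w, -, rfl⟩; exact ih w)

theorem coeff_mem_of_isClosed [CompleteSpace E] [CharZero K] {f : K → E} {c : ℕ → E}
    (h : ∀ z : K, HasSum (fun j : ℕ => z ^ j • c j) (f z)) {G : Submodule K E}
    (hG : IsClosed (G : Set E)) (hf : ∀ z, f z ∈ G) (j : ℕ) : c j ∈ G := by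
  have h1 := iteratedDeriv_mem_of_isClosed hG hf j 0
  rw [iteratedDeriv_zero_of_hasSum h] at h1
  exact (G.smul_mem_iff (Nat.cast_ne_zero.2 j.factorial_ne_zero)).1 h1

end PowerSeries

theorem Padic.norm_factorial_inv_le (p : ℕ) [hp : Fact p.Prime] (n : ℕ) :
    ‖(n.factorial : ℚ_[p])‖⁻¹ ≤ (p : ℝ) ^ n := by
  have hv : padicValNat p n.factorial ≤ n :=
    calc padicValNat p n.factorial ≤ (p - 1) * padicValNat p n.factorial :=
          Nat.le_mul_of_pos_left _ (Nat.sub_pos_of_lt hp.out.one_lt)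
      _ ≤ n := (sub_one_mul_padicValNat_factorial n).trans_le (Nat.sub_le _ _)
  rw [Padic.norm_eq_zpow_neg_valuation (Nat.cast_ne_zero.2 n.factorial_ne_zero),
    Padic.valuation_natCast, zpow_neg, inv_inv, zpow_natCast]
  exact pow_le_pow_right₀ (mod_cast hp.out.one_le) hv

section Operator

variable {K : Type*} [NontriviallyNormedField K]
  {B : Type*} [NormedAddCommGroup B] [NormedSpace K B]

/-- The graph of the restriction of `A` to `D`. -/
def graphOn (D : Submodule K B) (A : B →ₗ[K] B) : Submodule K (B × B) :=
  D.comap (LinearMap.fst K B B) ⊓ A.graph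

theorem mem_graphOn {D : Submodule K B} {A : B →ₗ[K] B} {q : B × B} :
    q ∈ graphOn D A ↔ q.1 ∈ D ∧ A q.1 = q.2 := by
  simp [graphOn, eq_comm]

/-- The Taylor coefficients of the formal solution of `y⁽ᵐ⁾ = A y` with initial values `v`. -/
noncomputable def cauchyCoeff (A : B →ₗ[K] B) (m : ℕ) (v : ℕ → B) (j : ℕ) : B :=
  (j.factorial : K)⁻¹ • (⇑A)^[j / m] (v (j % m))

theorem map_cauchyCoeff [CharZero K] (A : B →ₗ[K] B) {m : ℕ} (hm : 1 ≤ m) (v : ℕ → B) (j : ℕ) :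
    A (cauchyCoeff A m v j) = ((j + 1).ascFactorial m : K) • cauchyCoeff A m v (j + m) := by
  have hj : (j.factorial : K) ≠ 0 := Nat.cast_ne_zero.2 j.factorial_ne_zero
  have ha : ((j + 1).ascFactorial m : K) ≠ 0 :=
    Nat.cast_ne_zero.2 (Nat.ascFactorial_pos j m).ne'
  rw [cauchyCoeff, cauchyCoeff, Nat.add_div_right _ hm, Nat.add_mod_right, map_smul,
    Function.iterate_succ_apply', smul_smul, ← Nat.factorial_mul_ascFactorial, Nat.cast_mul]
  congr 1
  field_simp

theorem norm_cauchyCoeff_le {p : ℕ} [hp : Fact p.Prime] [Algebra ℚ_[p] K]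
    (hK : ∀ q : ℚ_[p], ‖algebraMap ℚ_[p] K q‖ = ‖q‖) (A : B →ₗ[K] B) {m : ℕ} (hm : 1 ≤ m)
    (v : ℕ → B) (hv : ∀ k < m, ∀ α > (0 : ℝ), ∃ C > (0 : ℝ), ∀ n : ℕ,
      ‖(⇑A)^[n] (v k)‖ ≤ C * α ^ n) {S : ℝ} (hS : 1 ≤ S) :
    ∃ C > (0 : ℝ), ∀ j, ‖cauchyCoeff A m v j‖ ≤ C * S⁻¹ ^ j := by
  have hp0 : (0 : ℝ) < p := mod_cast hp.out.pos
  have hp1 : (1 : ℝ) ≤ p := mod_cast hp.out.one_le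
  have hS0 : 0 < S := one_pos.trans_le hS
  obtain ⟨T, hT⟩ : ∃ T : ℝ, T = p * S := ⟨_, rfl⟩
  have hT1 : 1 ≤ T := hT ▸ one_le_mul_of_one_le_of_one_le hp1 hS
  have hT0 : 0 < T := one_pos.trans_le hT1
  choose! C hC0 hC using fun k hk => hv k hk (T⁻¹ ^ m) (by positivity)
  have hC' : ∀ k < m, C k ≤ ∑ i ∈ Finset.range m, C i := fun k hk =>
    Finset.single_le_sum (fun i hi => (hC0 i (Finset.mem_range.1 hi)).le) (Finset.mem_range.2 hk)
  have hsum : 0 < ∑ i ∈ Finset.range m, C i := (hC0 0 hm).trans_le (hC' 0 hm)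
  refine ⟨(∑ i ∈ Finset.range m, C i) * T ^ m, by positivity, fun j => ?_⟩
  have hjm : j % m < m := Nat.mod_lt _ hm
  have hfac : ‖(j.factorial : K)‖⁻¹ ≤ (p : ℝ) ^ j := by
    have h := hK (j.factorial : ℚ_[p])
    rw [map_natCast] at h
    exact h ▸ Padic.norm_factorial_inv_le p j
  have hpow : (T⁻¹ ^ m) ^ (j / m) ≤ T ^ m * T⁻¹ ^ j := by
    have h : T⁻¹ ^ j = T⁻¹ ^ (j % m) * (T⁻¹ ^ m) ^ (j / m) := by
      rw [← pow_mul, ← pow_add, Nat.mod_add_div]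
    rw [h, ← mul_assoc]
    refine le_mul_of_one_le_left (by positivity) ?_
    rw [inv_pow, ← div_eq_mul_inv, one_le_div (by positivity)]
    exact pow_le_pow_right₀ hT1 hjm.le
  calc ‖cauchyCoeff A m v j‖
      = ‖(j.factorial : K)‖⁻¹ * ‖(⇑A)^[j / m] (v (j % m))‖ := by
        rw [cauchyCoeff, norm_smul, norm_inv]
    _ ≤ (p : ℝ) ^ j * ((∑ i ∈ Finset.range m, C i) * (T ^ m * T⁻¹ ^ j)) := by
        refine mul_le_mul hfac ((hC _ hjm _).trans ?_) (norm_nonneg _) (by positivity)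
        exact mul_le_mul (hC' _ hjm) hpow (by positivity) hsum.le
    _ = (∑ i ∈ Finset.range m, C i) * T ^ m * S⁻¹ ^ j := by
        have h : (p : ℝ) ^ j * T⁻¹ ^ j = S⁻¹ ^ j := by
          rw [← mul_pow, hT, mul_inv, mul_inv_cancel_left₀ hp0.ne']
        rw [← h]
        ring

theorem summable_norm_mul_pow {c : ℕ → B}
    (hc : ∀ S : ℝ, 1 ≤ S → ∃ C > (0 : ℝ), ∀ j, ‖c j‖ ≤ C * S⁻¹ ^ j) {r : ℝ} (hr : 0 ≤ r) :
    Summable fun j : ℕ => ‖c j‖ * r ^ j := by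
  obtain ⟨C, -, hC⟩ := hc (r + 1) (by linarith)
  refine Summable.of_nonneg_of_le (fun j => by positivity) (fun j => ?_)
    ((summable_geometric_of_lt_one (r := (r + 1)⁻¹ * r) (by positivity) ?_).mul_left C)
  · rw [mul_pow, ← mul_assoc]
    exact mul_le_mul_of_nonneg_right (hC j) (by positivity)
  · rw [inv_mul_lt_one₀ (by positivity)]
    exact lt_add_one r

end Operator

theorem entire_solution_iff
    {p : ℕ} [Fact p.Prime]
    {K : Type*} [NontriviallyNormedField K] [CompleteSpace K] [IsAlgClosed K]
    [IsUltrametricDist K] [Algebra ℚ_[p] K]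
    (hK : ∀ q : ℚ_[p], ‖algebraMap ℚ_[p] K q‖ = ‖q‖)
    {B : Type*} [NormedAddCommGroup B] [NormedSpace K B] [CompleteSpace B]
    [IsUltrametricDist B]
    (D : Submodule K B) (A : B →ₗ[K] B)
    (hA : IsClosed {q : B × B | q.1 ∈ D ∧ A q.1 = q.2})
    (m : ℕ) (hm : 1 ≤ m) (yinit : ℕ → B) :
    (∃ (y : K → B) (c : ℕ → B), IsEntireCauchySolution D A m yinit y c) ↔
      (∀ k < m, ∀ α > (0 : ℝ), (∀ n : ℕ, (⇑A)^[n] (yinit k) ∈ D) ∧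
        ∃ C > (0 : ℝ), ∀ n : ℕ, ‖(⇑A)^[n] (yinit k)‖ ≤ C * α ^ n) := by
  have : CharZero K := charZero_of_injective_algebraMap (algebraMap ℚ_[p] K).injective
  have hG : IsClosed (graphOn D A : Set (B × B)) := by
    convert hA using 1
    ext q
    exact mem_graphOn
  constructor
  · rintro ⟨y, c, hdecay, hy, hyD, -, heq, hinit⟩ k hk α hα
    have hcoeff := coeff_mem_of_isClosed (f := fun z => (y z, iteratedDeriv m y z))
      (c := fun j => (c j, ((j + 1).ascFactorial m : K) • c (j + m)))
      (fun z => ((hy z).prodMk (hasSum_iteratedDeriv_of_hasSum hy m z))) hG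
      fun z => mem_graphOn.2 ⟨hyD z, (heq z).symm⟩
    have hcoeff' (j : ℕ) : c j ∈ D ∧ A (c j) = ((j + 1).ascFactorial m : K) • c (j + m) :=
      mem_graphOn.1 (hcoeff j)
    have hiter (n : ℕ) :
        (⇑A)^[n] (yinit k) = ((k + n * m).factorial : K) • c (k + n * m) := by
      induction n with
      | zero => simpa using (hinit k hk).2.symm
      | succ n ih =>
        rw [Function.iterate_succ_apply', ih, map_smul, (hcoeff' _).2, smul_smul,
          ← Nat.cast_mul, Nat.factorial_mul_ascFactorial, Nat.succ_mul, add_assoc]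
    refine ⟨fun n => hiter n ▸ D.smul_mem _ (hcoeff' _).1, ?_⟩
    obtain ⟨r, hr⟩ : ∃ r : ℝ, r = max 1 α⁻¹ := ⟨_, rfl⟩
    have hr1 : 1 ≤ r := hr ▸ le_max_left _ _
    have hrα : α⁻¹ ≤ r := hr ▸ le_max_right _ _
    have hr0 : 0 < r := one_pos.trans_le hr1
    obtain ⟨C, hC⟩ := (hdecay r hr0).bddAbove_range
    have hC' (j : ℕ) : ‖c j‖ * r ^ j ≤ max C 1 := (hC ⟨j, rfl⟩).trans (le_max_left _ _)
    refine ⟨max C 1, by positivity, fun n => ?_⟩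
    have hle : (α⁻¹) ^ n ≤ r ^ (k + n * m) :=
      (pow_le_pow_left₀ (by positivity) hrα n).trans
        (pow_le_pow_right₀ hr1 ((Nat.le_mul_of_pos_right n hm).trans (Nat.le_add_left _ _)))
    calc ‖(⇑A)^[n] (yinit k)‖ ≤ ‖c (k + n * m)‖ := by
          rw [hiter, norm_smul]
          exact mul_le_of_le_one_left (norm_nonneg _)
            (IsUltrametricDist.norm_natCast_le_one K _)
      _ = ‖c (k + n * m)‖ * α⁻¹ ^ n * α ^ n := by
          rw [mul_assoc, ← mul_pow, inv_mul_cancel₀ hα.ne', one_pow, mul_one]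
      _ ≤ max C 1 * α ^ n := by
          refine mul_le_mul_of_nonneg_right (le_trans ?_ (hC' (k + n * m))) (by positivity)
          exact mul_le_mul_of_nonneg_left hle (norm_nonneg _)
  · intro h
    have hmem (k : ℕ) (hk : k < m) := (h k hk 1 one_pos).1
    obtain ⟨c, hc⟩ : ∃ c, c = cauchyCoeff A m yinit := ⟨_, rfl⟩
    have hsum {r : ℝ} (hr : 0 ≤ r) : Summable fun j : ℕ => ‖c j‖ * r ^ j :=
      summable_norm_mul_pow (fun S hS => hc ▸ norm_cauchyCoeff_le hK A hm yinit
        (fun k hk α hα => (h k hk α hα).2) hS) hr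
    have hy (z : K) : HasSum (fun j : ℕ => z ^ j • c j) (∑' j : ℕ, z ^ j • c j) := by
      refine (Summable.of_norm ?_).hasSum
      simpa [norm_smul, mul_comm] using hsum (norm_nonneg z)
    have hcD (j : ℕ) : c j ∈ D := hc ▸ D.smul_mem _ (hmem _ (Nat.mod_lt _ hm) _)
    have hgraph (z : K) := mem_graphOn.1 <| hG.mem_of_tendsto
      ((hy z).prodMk (hasSum_iteratedDeriv_of_hasSum hy m z)) <| Eventually.of_forall fun s =>
        (graphOn D A).sum_mem fun j _ => mem_graphOn.2 ⟨D.smul_mem _ (hcD j), by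
          rw [map_smul, hc, map_cauchyCoeff A hm]⟩
    have hck (k : ℕ) (hk : k < m) : (k.factorial : K) • c k = yinit k := by
      rw [hc, cauchyCoeff, Nat.div_eq_of_lt hk, Nat.mod_eq_of_lt hk, Function.iterate_zero_apply,
        smul_inv_smul₀ (Nat.cast_ne_zero.2 k.factorial_ne_zero)]
    exact ⟨fun z => ∑' j : ℕ, z ^ j • c j, c,
      fun r hr => (hsum hr.le).tendsto_atTop_zero, hy, fun z => (hgraph z).1,
      fun i _ z => differentiable_of_hasSum (hasSum_iteratedDeriv_of_hasSum hy i) z,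
      fun z => (hgraph z).2.symm,
      fun k hk => ⟨(iteratedDeriv_zero_of_hasSum hy k).trans (hck k hk), hck k hk⟩⟩
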